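/- arXiv:math/0009164 — 2 statements merged into one kernel-verified Lean document; each statement's English description precedes it below -/
import Mathlib

section
/- Let K ⊆ ℝ² be a simple set with complementary domains W₁, W₂, let x ∈ K, and let (xₙ)_{n≥1} be a sequence of pairwise distinct points with xₙ ≠ x such that xₙ lies in K(B(x,1/n), x) ∩ A₁ for every n, and let αₙ : [0,1] → ℝ² be an end-cut of W₁ at xₙ for every n. Then there exists a family of cross-cuts βₙ : [0,1] → ℝ² (n ≥ 2) of W₁ such that: (i) βₙ joins the points xₙ and x_{n+1}; (ii) βₙ([0,1]) ⊆ B(x, 1/(n−1)); (iii) for every n ≥ 2 there exists τₙ > 0 such that α₂([0,τ₂]) ⊆ β₂([0,1]) and αₙ([0,τₙ]) ⊆ β_{n−1}([0,1]) ∩ βₙ([0,1]) for n ≥ 3. -/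
open Set Metric Topology

noncomputable section

/-- The plane `ℝ²`. -/
abbrev Plane : Type := EuclideanSpace ℝ (Fin 2)

/-- `φ` is an end-cut of the open set `U` at the point `x`: an injective continuous map
`[0,1] → ℝ²` with `φ 0 = x` and `φ ((0,1]) ⊆ U`. -/
def IsEndCut (U : Set Plane) (x : Plane) (φ : unitInterval → Plane) : Prop :=
  Continuous φ ∧ Function.Injective φ ∧ φ 0 = x ∧
    ∀ t : unitInterval, t ≠ 0 → φ t ∈ U

/-- The point `x` (on the frontier of `U`) is accessible from `U`. -/
def Accessible (U : Set Plane) (x : Plane) : Prop :=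
  x ∈ frontier U ∧ ∃ φ : unitInterval → Plane, IsEndCut U x φ

/-- `ψ` is a cross-cut of the open set `U`: an injective continuous map `[0,1] → ℝ²`
with `ψ 0, ψ 1 ∈ frontier U` and `ψ ((0,1)) ⊆ U`. -/
def IsCrossCut (U : Set Plane) (ψ : unitInterval → Plane) : Prop :=
  Continuous ψ ∧ Function.Injective ψ ∧ ψ 0 ∈ frontier U ∧ ψ 1 ∈ frontier U ∧
    ∀ t : unitInterval, t ≠ 0 → t ≠ 1 → ψ t ∈ U

/-- `K` is a compact set whose complement has exactly two connected components
`W₁` and `W₂`. -/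
def TwoSided (K W₁ W₂ : Set Plane) : Prop :=
  IsCompact K ∧ W₁ ≠ W₂ ∧
    (∃ x ∈ Kᶜ, connectedComponentIn Kᶜ x = W₁) ∧
    (∃ x ∈ Kᶜ, connectedComponentIn Kᶜ x = W₂) ∧
    ∀ x ∈ Kᶜ, connectedComponentIn Kᶜ x = W₁ ∨ connectedComponentIn Kᶜ x = W₂

/-- The set of points of `K` accessible from `W`. -/
def AccPts (K W : Set Plane) : Set Plane := {x ∈ K | Accessible W x}

/-- `R` is sufficiently dense in `F`: for every `x ∈ F` and every open neighborhood `U`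
of `x`, the connected component `F(U,x)` of `x` in `F ∩ U` meets `R`. -/
def SuffDense (F R : Set Plane) : Prop :=
  ∀ x ∈ F, ∀ U : Set Plane, IsOpen U → x ∈ U →
    (connectedComponentIn (F ∩ U) x ∩ R).Nonempty

/-- `K` is a d-set: a two-sided set such that both `A₁` and `A₂` are sufficiently
dense in `K`. -/
def IsDSet (K W₁ W₂ : Set Plane) : Prop :=
  TwoSided K W₁ W₂ ∧ SuffDense K (AccPts K W₁) ∧ SuffDense K (AccPts K W₂)

/-- `K` is a simple set: a two-sided set such that both `A₁` and `A₂` are dense in `K`. -/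
def IsSimpleSet (K W₁ W₂ : Set Plane) : Prop :=
  TwoSided K W₁ W₂ ∧ K ⊆ closure (AccPts K W₁) ∧ K ⊆ closure (AccPts K W₂)

/-- `K` is a simple closed curve: it is homeomorphic to the unit circle. -/
def IsSimpleClosedCurve (K : Set Plane) : Prop :=
  Nonempty (K ≃ₜ (Metric.sphere (0 : Plane) 1 : Set Plane))

/-- The topology `LC(X)` generated by the connected components of open subsets of `X`. -/
def LC (X : Type*) [TopologicalSpace X] : TopologicalSpace X :=
  TopologicalSpace.generateFrom
    {C : Set X | ∃ U : Set X, IsOpen U ∧ ∃ x ∈ U, connectedComponentIn U x = C}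

/-- A topological space is zero-dimensional if it has a basis of clopen sets. -/
def ZeroDimensional (X : Type*) [TopologicalSpace X] : Prop :=
  ∀ (x : X) (U : Set X), IsOpen U → x ∈ U →
    ∃ V : Set X, IsClopen V ∧ x ∈ V ∧ V ⊆ U

/-- On a preconnected set, a continuous logarithm of a constant function is constant. -/
lemma eq_of_exp_eq_const {X : Type*} [TopologicalSpace X] {T : Set X} (hT : IsPreconnected T)
    {g : X → ℂ} (hg : ContinuousOn g T) {k : ℂ} (hk : ∀ z ∈ T, Complex.exp (g z) = k)
    {a b : X} (ha : a ∈ T) (hb : b ∈ T) : g a = g b := by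
  have hdisc : IsDiscrete (Set.range fun n : ℤ => 2 * (Real.pi : ℂ) * Complex.I * (n : ℂ)) := by
    have h1 : IsDiscrete (Set.range ((↑) : ℤ → ℝ)) :=
      Int.isClosedEmbedding_coe_real.isEmbedding.isInducing.isDiscrete_range
    have h2 := h1.image Complex.isometry_ofReal.isEmbedding.isInducing
    have h3 := h2.image (Homeomorph.mulLeft₀ (2 * (Real.pi : ℂ) * Complex.I)
      Complex.two_pi_I_ne_zero).isInducing
    rw [← Set.range_comp, ← Set.range_comp] at h3
    convert h3 using 2
    ext n
    simp
  have hmaps : MapsTo (fun z => g z - g b) T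
      (Set.range fun n : ℤ => 2 * (Real.pi : ℂ) * Complex.I * (n : ℂ)) := by
    intro z hz
    have h1 : Complex.exp (g z - g b) = 1 := by
      rw [Complex.exp_sub, hk z hz, ← hk b hb, div_self (Complex.exp_ne_zero _)]
    obtain ⟨n, hn⟩ := Complex.exp_eq_one_iff.1 h1
    exact ⟨n, by simp only [hn]; ring⟩
  have := hT.constant_of_mapsTo hdisc (hg.sub continuousOn_const) hmaps ha hb
  exact sub_left_injective this

/-- Along a preconnected family of nonvanishing functions that varies slowly, the quotient of any
two members has a continuous logarithm. -/
lemma exists_log_of_family {X ι : Type*} [TopologicalSpace X] [TopologicalSpace ι] {S : Set ι}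
    (hS : IsPreconnected S) {T : Set X} {F : ι → X → ℂ} (hF : ∀ c ∈ S, ContinuousOn (F c) T)
    (h0 : ∀ c ∈ S, ∀ z ∈ T, F c z ≠ 0)
    (hloc : ∀ c ∈ S, ∀ᶠ c' in 𝓝[S] c, ∀ z ∈ T, ‖F c' z - F c z‖ < ‖F c z‖)
    {a b : ι} (ha : a ∈ S) (hb : b ∈ S) :
    ∃ L : X → ℂ, ContinuousOn L T ∧ ∀ z ∈ T, F a z * Complex.exp (L z) = F b z := by
  have key : ∀ c ∈ S, ∀ c' ∈ S, (∀ z ∈ T, ‖F c' z - F c z‖ < ‖F c z‖) →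
      ∃ L : X → ℂ, ContinuousOn L T ∧ ∀ z ∈ T, F c z * Complex.exp (L z) = F c' z := by
    intro c hc c' hc' hlt
    refine ⟨fun z => Complex.log (F c' z / F c z),
      ((hF c' hc').div (hF c hc) (h0 c hc)).clog fun z hz => ?_, fun z hz => ?_⟩
    · have hlt1 : ‖F c' z / F c z - 1‖ < 1 := by
        rw [div_sub_one (h0 c hc z hz), norm_div, div_lt_one (norm_pos_iff.2 (h0 c hc z hz))]
        exact hlt z hz
      simpa using Complex.mem_slitPlane_of_norm_lt_one hlt1
    · rw [Complex.exp_log (div_ne_zero (h0 c' hc' z hz) (h0 c hc z hz)),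
        mul_div_cancel₀ _ (h0 c hc z hz)]
  refine hS.induction₂' (fun c c' => ∃ L : X → ℂ, ContinuousOn L T ∧
    ∀ z ∈ T, F c z * Complex.exp (L z) = F c' z) ?_ ?_ ha hb
  · intro c hc
    filter_upwards [hloc c hc, self_mem_nhdsWithin] with c' h1 h2
    obtain ⟨L, hL, hLe⟩ := key c hc c' h2 h1
    refine ⟨⟨L, hL, hLe⟩, fun z => -L z, hL.neg, fun z hz => ?_⟩
    rw [← hLe z hz, mul_assoc, ← Complex.exp_add, add_neg_cancel, Complex.exp_zero, mul_one]
  · rintro c₁ c₂ c₃ - - - ⟨L, hL, hLe⟩ ⟨M, hM, hMe⟩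
    refine ⟨fun z => L z + M z, hL.add hM, fun z hz => ?_⟩
    rw [Complex.exp_add, ← mul_assoc, hLe z hz, hMe z hz]

/-- The standard isometry from the plane to `ℂ`. -/
def planeToComplex : Plane ≃ₗᵢ[ℝ] ℂ := Complex.orthonormalBasisOneI.repr.symm

lemma norm_planeToComplex_sub (z w : Plane) :
    ‖planeToComplex z - planeToComplex w‖ = dist z w := by
  rw [← map_sub, LinearIsometryEquiv.norm_map, dist_eq_norm]

lemma planeToComplex_sub_ne_zero {z w : Plane} (h : z ≠ w) :
    planeToComplex z - planeToComplex w ≠ 0 :=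
  sub_ne_zero.2 fun h' => h (planeToComplex.injective h')

/-- Two points of a compact connected set `C` are not separated by a closed set disjoint from
`C`, in the sense that the quotient of the linear functions vanishing at them has a logarithm. -/
lemma exists_log_of_disjoint {C T : Set Plane} (hC : IsPreconnected C) (hCc : IsCompact C)
    (hT : IsClosed T) (hd : Disjoint C T) {p q : Plane} (hp : p ∈ C) (hq : q ∈ C) :
    ∃ L : Plane → ℂ, ContinuousOn L T ∧ ∀ z ∈ T,
      (planeToComplex z - planeToComplex p) * Complex.exp (L z) =
        planeToComplex z - planeToComplex q := by
  obtain ⟨r, hr, hlt⟩ := exists_pos_forall_lt_edist hCc hT hd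
  have hdist : ∀ c ∈ C, ∀ z ∈ T, (r : ℝ) < dist z c := by
    intro c hc z hz
    have := hlt c hc z hz
    rw [edist_nndist, ENNReal.coe_lt_coe, ← NNReal.coe_lt_coe, coe_nndist] at this
    rwa [dist_comm]
  refine exists_log_of_family (F := fun c z => planeToComplex z - planeToComplex c) hC
    (fun c _ => (planeToComplex.continuous.sub continuous_const).continuousOn)
    (fun c hc z hz => planeToComplex_sub_ne_zero ?_) (fun c hc => ?_) hp hq
  · rintro rfl
    have := hdist z hc z hz
    rw [dist_self] at this
    exact absurd this (not_lt.2 r.coe_nonneg)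
  · filter_upwards [nhdsWithin_le_nhds (ball_mem_nhds c (NNReal.coe_pos.2 hr))] with c' hc' z hz
    rw [norm_planeToComplex_sub, sub_sub_sub_cancel_left, norm_planeToComplex_sub, dist_comm]
    exact (mem_ball.1 hc').trans (hdist c hc z hz)

/-- The frontier of a bounded set separates its points from the points outside its
closure. -/
lemma not_exists_log_frontier {U : Set Plane} (hb : Bornology.IsBounded U)
    {p q : Plane} (hp : p ∈ U) (hq : q ∉ closure U) {L : Plane → ℂ}
    (hL : ContinuousOn L (frontier U))
    (hexp : ∀ z ∈ frontier U, (planeToComplex z - planeToComplex p) * Complex.exp (L z) =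
        planeToComplex z - planeToComplex q) : False := by
  classical
  obtain ⟨M, hM⟩ := ContinuousMap.exists_restrict_eq (Y := ℂ) (isClosed_frontier (s := U))
    ⟨_, hL.domRestrict⟩
  have hML : ∀ z ∈ frontier U, M z = L z := fun z hz => DFunLike.congr_fun hM ⟨z, hz⟩
  set h : Plane → ℂ := (closure U).piecewise
    (fun z => (planeToComplex z - planeToComplex q) * Complex.exp (-M z))
    (fun z => planeToComplex z - planeToComplex p) with hdef
  have hcont : Continuous h := by
    refine Continuous.piecewise (fun z hz => ?_) ?_ ?_
    · have hz' := frontier_closure_subset hz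
      rw [hML z hz', ← hexp z hz', mul_assoc, ← Complex.exp_add, add_neg_cancel,
        Complex.exp_zero, mul_one]
    · exact (planeToComplex.continuous.sub continuous_const).mul
        (Complex.continuous_exp.comp M.continuous.neg)
    · exact planeToComplex.continuous.sub continuous_const
  have hne : ∀ z, h z ≠ 0 := by
    intro z
    by_cases hz : z ∈ closure U
    · rw [hdef, Set.piecewise_eq_of_mem _ _ _ hz]
      exact mul_ne_zero (planeToComplex_sub_ne_zero fun e => hq (e ▸ hz)) (Complex.exp_ne_zero _)
    · rw [hdef, Set.piecewise_eq_of_notMem _ _ _ hz]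
      exact planeToComplex_sub_ne_zero fun e => hz (e ▸ subset_closure hp)
  obtain ⟨R, hR0, hR⟩ := hb.closure.subset_ball_lt 0 p
  obtain ⟨N, hN, hNe⟩ := exists_log_of_family (S := Icc (0 : ℝ) 1) (T := closedBall p R)
    (F := fun t z => h (p + t • (z - p))) isPreconnected_Icc
    (fun t _ => by fun_prop) (fun t _ z _ => hne _) (fun t _ => by
      refine nhdsWithin_le_nhds
        ((isCompact_closedBall p R).eventually_forall_of_forall_eventually fun z _ => ?_)
      have hc1 : Continuous fun y : ℝ × Plane =>
          ‖h (p + y.1 • (y.2 - p)) - h (p + t • (y.2 - p))‖ := by fun_prop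
      have hc2 : Continuous fun y : ℝ × Plane => ‖h (p + t • (y.2 - p))‖ := by fun_prop
      refine hc1.continuousAt.eventually_lt hc2.continuousAt ?_
      simpa using hne _)
    (left_mem_Icc.2 zero_le_one) (right_mem_Icc.2 zero_le_one)
  simp only [zero_smul, add_zero, one_smul, add_sub_cancel] at hNe
  set c : ℝ → Plane := fun θ => p + planeToComplex.symm (R * Complex.exp (θ * Complex.I)) with hc
  have hcc : Continuous c := by
    have := planeToComplex.symm.continuous
    fun_prop
  have hdc : ∀ θ, dist (c θ) p = R := by
    intro θ
    rw [hc, dist_eq_norm, add_sub_cancel_left, LinearIsometryEquiv.norm_map, norm_mul,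
      Complex.norm_exp_ofReal_mul_I, mul_one, Complex.norm_real, Real.norm_of_nonneg hR0.le]
  have hcb : ∀ θ, c θ ∈ closedBall p R := fun θ => (hdc θ).le
  have hhc : ∀ θ, h (c θ) = R * Complex.exp (θ * Complex.I) := by
    intro θ
    have : c θ ∉ closure U := fun hmem => absurd (hR hmem) (by simp [hdc θ])
    rw [hdef, Set.piecewise_eq_of_notMem _ _ _ this, ← map_sub, hc, add_sub_cancel_left,
      LinearIsometryEquiv.apply_symm_apply]
  have hconst := eq_of_exp_eq_const (T := (univ : Set ℝ)) isPreconnected_univ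
    (g := fun θ : ℝ => N (c θ) - θ * Complex.I) (k := R / h p)
    ((hN.comp hcc.continuousOn fun θ _ => hcb θ).sub (by fun_prop))
    (fun θ _ => by
      have h1 := hNe _ (hcb θ)
      rw [hhc] at h1
      rw [Complex.exp_sub, eq_div_iff (hne p), div_mul_eq_mul_div, mul_comm, h1,
        mul_div_cancel_right₀ _ (Complex.exp_ne_zero _)])
    (mem_univ 0) (mem_univ (2 * Real.pi))
  have hper : c (2 * Real.pi) = c 0 := by simp [hc]
  simp only [hper, Complex.ofReal_zero, zero_mul, sub_zero] at hconst
  have : (((2 * Real.pi : ℝ) : ℂ)) * Complex.I = 0 := by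
    linear_combination hconst
  simp [Real.pi_ne_zero] at this

lemma isPreconnected_plane_sphere (x : Plane) (r : ℝ) : IsPreconnected (sphere x r) :=
  isPreconnected_sphere (by
    rw [← Module.finrank_eq_rank, finrank_euclideanSpace_fin]
    norm_num) x r

/-- Two points of an open connected set lie in a compact connected subset of it. -/
lemma exists_compact_connected_subset {W : Set Plane} (hW : IsOpen W) (hWc : IsPreconnected W)
    {p q : Plane} (hp : p ∈ W) (hq : q ∈ W) :
    ∃ G ⊆ W, IsCompact G ∧ IsPreconnected G ∧ p ∈ G ∧ q ∈ G := by
  have hpc : IsPathConnected W := (hW.isConnected_iff_isPathConnected).1 ⟨⟨p, hp⟩, hWc⟩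
  obtain ⟨γ, hγ⟩ := hpc.joinedIn p hp q hq
  exact ⟨Set.range γ, Set.range_subset_iff.2 hγ, isCompact_range γ.continuous,
    isPreconnected_range γ.continuous, ⟨0, γ.source⟩, ⟨1, γ.target⟩⟩

/-- Two continuous logarithms of the same quotient differ by a constant on a preconnected set. -/
lemma log_sub_log_eq {T : Set Plane} (hT : IsPreconnected T) {p q : Plane} (hp : p ∉ T)
    {L M : Plane → ℂ} (hL : ContinuousOn L T) (hM : ContinuousOn M T)
    (hLe : ∀ z ∈ T, (planeToComplex z - planeToComplex p) * Complex.exp (L z) =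
      planeToComplex z - planeToComplex q)
    (hMe : ∀ z ∈ T, (planeToComplex z - planeToComplex p) * Complex.exp (M z) =
      planeToComplex z - planeToComplex q)
    {c d : Plane} (hc : c ∈ T) (hd : d ∈ T) : L c - M c = L d - M d := by
  refine eq_of_exp_eq_const hT (g := fun z => L z - M z) (k := 1) (hL.sub hM) (fun z hz => ?_)
    hc hd
  have h0 := planeToComplex_sub_ne_zero (z := z) (w := p) fun h => hp (h ▸ hz)
  rw [Complex.exp_sub, div_eq_one_iff_eq (Complex.exp_ne_zero _)]
  exact mul_left_cancel₀ h0 ((hLe z hz).trans (hMe z hz).symm)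

/-- A point of the closure of a set `W` and avoiding a closed set `F` is joined to `W` by a
segment avoiding `F`. -/
lemma exists_segment_disjoint {W F : Set Plane} (hF : IsClosed F) {c : Plane}
    (hc : c ∈ closure W) (hcF : c ∉ F) : ∃ c' ∈ W, Disjoint F (segment ℝ c c') := by
  obtain ⟨ε, hε, hsub⟩ := Metric.isOpen_iff.1 hF.isOpen_compl c hcF
  obtain ⟨c', hc', hd⟩ := Metric.mem_closure_iff.1 hc ε hε
  refine ⟨c', hc', Set.disjoint_left.2 fun z hz hz' => hsub ?_ hz⟩
  exact (convex_ball c ε).segment_subset (mem_ball_self hε) (by rwa [mem_ball, dist_comm]) hz'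

/-- Let `W₁, W₂` be disjoint domains with `W₁ ∪ W₂ = Kᶜ` and `K ⊆ closure W₂`. If a continuum in
`K ∪ W₁` and in a disc `B` contains `p, q ∈ W₁`, then `p` and `q` lie in the same component of
`W₁ ∩ B`. -/
lemma mem_connectedComponentIn_inter_ball {K W₁ W₂ Q : Set Plane} (h₁ : IsOpen W₁)
    (h₁c : IsPreconnected W₁) (h₂ : IsOpen W₂) (h₂c : IsPreconnected W₂) (hd : Disjoint W₁ W₂)
    (hK : W₁ ∪ W₂ = Kᶜ) (hcl : K ⊆ closure W₂) {x : Plane} {r : ℝ} (hQ : IsCompact Q)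
    (hQc : IsPreconnected Q) (hQB : Q ⊆ ball x r) (hQK : Q ⊆ K ∪ W₁) {p q : Plane} (hpQ : p ∈ Q)
    (hqQ : q ∈ Q) (hp : p ∈ W₁) (hq : q ∈ W₁) :
    q ∈ connectedComponentIn (W₁ ∩ ball x r) p := by
  by_contra hnot
  set U := connectedComponentIn (W₁ ∩ ball x r) p with hU
  have hUo : IsOpen U := (h₁.inter isOpen_ball).connectedComponentIn
  have hpU : p ∈ U := mem_connectedComponentIn ⟨hp, hQB hpQ⟩
  have hUsub : U ⊆ W₁ ∩ ball x r := connectedComponentIn_subset _ _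
  have hUcl : ∀ z ∈ closure U, z ∈ W₁ ∩ ball x r → z ∈ U := by
    intro z hz hzW
    have hpre : IsPreconnected (insert z U) :=
      isPreconnected_connectedComponentIn.subset_closure (Set.subset_insert _ _)
        (Set.insert_subset hz subset_closure)
    exact hpre.subset_connectedComponentIn (Set.mem_insert_of_mem _ hpU)
      (Set.insert_subset hzW hUsub) (Set.mem_insert _ _)
  have hKcl : IsClosed K := by
    rw [← isOpen_compl_iff, ← hK]
    exact h₁.union h₂
  have hfr : ∀ z ∈ frontier U, z ∈ K ∨ z ∈ sphere x r := by
    intro z hz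
    rw [hUo.frontier_eq] at hz
    by_contra! hcon
    have hzc : z ∈ closedBall x r :=
      closure_minimal (hUsub.trans (inter_subset_right.trans ball_subset_closedBall))
        isClosed_closedBall hz.1
    have hzb : z ∈ ball x r := lt_of_le_of_ne hzc hcon.2
    have hzW : z ∈ W₁ ∪ W₂ := hK ▸ hcon.1
    rcases hzW with hzW | hzW
    · exact hz.2 (hUcl z hz.1 ⟨hzW, hzb⟩)
    · exact (hd.closure_left h₂).le_bot
        ⟨closure_mono (hUsub.trans inter_subset_left) hz.1, hzW⟩
  have hqcl : q ∉ closure U := fun h => hnot (hUcl q h ⟨hq, hQB hqQ⟩)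
  have hKW : K ∪ W₂ = W₁ᶜ := by
    ext z
    have h1 : z ∈ W₁ ∪ W₂ ↔ z ∈ Kᶜ := by rw [hK]
    have h2 : z ∈ W₁ → z ∉ W₂ := fun a b => hd.le_bot ⟨a, b⟩
    simp only [Set.mem_union, Set.mem_compl_iff] at h1 ⊢
    tauto
  have hKW₁ : K ⊆ W₁ᶜ := hKW ▸ subset_union_left
  have hW₁c : IsPreconnected W₁ᶜ := by
    rw [← hKW]
    exact h₂c.subset_closure subset_union_right (Set.union_subset hcl subset_closure)
  obtain ⟨G, hGW, hGcpt, hGc, hpG, hqG⟩ := exists_compact_connected_subset h₁ h₁c hp hq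
  have hQS : Disjoint Q (sphere x r) := disjoint_left.2 fun z hz hz' =>
    absurd (hQB hz) (by simp [mem_sphere.1 hz'])
  have hGW' : Disjoint G W₁ᶜ := disjoint_compl_right_iff_subset.2 hGW
  obtain ⟨LS, hLS, hLSe⟩ := exists_log_of_disjoint hQc hQ isClosed_sphere hQS hpQ hqQ
  obtain ⟨LG, hLG, hLGe⟩ := exists_log_of_disjoint hGc hGcpt h₁.isClosed_compl hGW' hpG hqG
  have hpS : ∀ {z : Plane}, z ∈ Q → z ∉ sphere x r := fun hz hz' => hQS.le_bot ⟨hz, hz'⟩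
  have hconst : ∀ c ∈ K ∩ sphere x r, ∀ d ∈ K ∩ sphere x r, LS c - LG c = LS d - LG d := by
    intro c hc d hd'
    have hK₁ : ∀ z ∈ K, z ∉ G := fun z hz hz' => hKW₁ hz (hGW hz')
    have hQG : IsClosed (Q ∪ G) := hQ.isClosed.union hGcpt.isClosed
    obtain ⟨c', hc', hcs⟩ := exists_segment_disjoint hQG (hcl hc.1)
      (fun h => h.elim (fun h => hpS h hc.2) (hK₁ c hc.1))
    obtain ⟨d', hd'', hds⟩ := exists_segment_disjoint hQG (hcl hd'.1)
      (fun h => h.elim (fun h => hpS h hd'.2) (hK₁ d hd'.1))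
    obtain ⟨H, hHW, hHcpt, hHc, hcH, hdH⟩ := exists_compact_connected_subset h₂ h₂c hc' hd''
    set T := segment ℝ c c' ∪ H ∪ segment ℝ d d' with hT
    have hTc : IsPreconnected T := by
      refine IsPreconnected.union d' (Or.inr hdH) (right_mem_segment ℝ d d') ?_
        (convex_segment d d').isPreconnected
      exact IsPreconnected.union c' (right_mem_segment ℝ c c') hcH
        (convex_segment c c').isPreconnected hHc
    have hseg : ∀ a b : Plane, IsCompact (segment ℝ a b) := fun a b => by
      rw [segment_eq_image_lineMap]
      exact isCompact_Icc.image AffineMap.lineMap_continuous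
    have hTcl : IsClosed T := (((hseg c c').union hHcpt).union (hseg d d')).isClosed
    have hQGT : Disjoint (Q ∪ G) T := by
      refine disjoint_union_right.2 ⟨disjoint_union_right.2 ⟨hcs, ?_⟩, hds⟩
      refine disjoint_left.2 fun z hz hzH => ?_
      have hzW : z ∉ W₁ := fun h => hd.le_bot ⟨h, hHW hzH⟩
      have hzK : z ∈ Kᶜ := hK ▸ Or.inr (hHW hzH)
      exact hz.elim (fun h => (hQK h).elim hzK hzW) fun h => hzW (hGW h)
    obtain ⟨hQT, hGT⟩ := disjoint_union_left.1 hQGT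
    obtain ⟨M, hM, hMe⟩ := exists_log_of_disjoint hQc hQ (isClosed_sphere.union hTcl)
      (disjoint_union_right.2 ⟨hQS, hQT⟩) hpQ hqQ
    obtain ⟨N, hN, hNe⟩ := exists_log_of_disjoint hGc hGcpt (h₁.isClosed_compl.union hTcl)
      (disjoint_union_right.2 ⟨hGW', hGT⟩) hpG hqG
    have hcT : c ∈ T := Or.inl (Or.inl (left_mem_segment ℝ c c'))
    have hdT : d ∈ T := Or.inr (left_mem_segment ℝ d d')
    have e1 := log_sub_log_eq (isPreconnected_plane_sphere x r) (hpS hpQ) hLS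
      (hM.mono subset_union_left) hLSe (fun z hz => hMe z (Or.inl hz)) hc.2 hd'.2
    have e2 := log_sub_log_eq hTc (fun h => hQT.le_bot ⟨hpQ, h⟩)
      (hM.mono subset_union_right) (hN.mono subset_union_right)
      (fun z hz => hMe z (Or.inr hz)) (fun z hz => hNe z (Or.inr hz)) hcT hdT
    have e3 := log_sub_log_eq hW₁c (fun h => h hp)
      (hN.mono subset_union_left) hLG (fun z hz => hNe z (Or.inl hz)) hLGe
      (hKW₁ hc.1) (hKW₁ hd'.1)
    linear_combination e1 + e2 + e3
  obtain ⟨k, hk1, hk⟩ : ∃ k : ℂ, Complex.exp k = 1 ∧ ∀ z ∈ K ∩ sphere x r, LS z = LG z + k := by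
    rcases (K ∩ sphere x r).eq_empty_or_nonempty with he | ⟨c, hc⟩
    · exact ⟨0, Complex.exp_zero, by simp [he]⟩
    · refine ⟨LS c - LG c, ?_, fun z hz => ?_⟩
      · have h0 := planeToComplex_sub_ne_zero (z := c) (w := p) fun h => hpS hpQ (h ▸ hc.2)
        rw [Complex.exp_sub, div_eq_one_iff_eq (Complex.exp_ne_zero _)]
        exact mul_left_cancel₀ h0
          ((hLSe c hc.2).trans (hLGe c (hKW₁ hc.1)).symm)
      · rw [hconst c hc z hz, add_sub_cancel]
  classical
  set L : Plane → ℂ := K.piecewise (fun z => LG z + k) LS with hL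
  have hLK : ∀ z ∈ K, L z = LG z + k := fun z hz => Set.piecewise_eq_of_mem _ _ _ hz
  have hLsph : ∀ z ∈ sphere x r, L z = LS z := by
    intro z hz
    by_cases hzK : z ∈ K
    · rw [hLK z hzK, hk z ⟨hzK, hz⟩]
    · exact Set.piecewise_eq_of_notMem _ _ _ hzK
  have hLc : ContinuousOn L (K ∪ sphere x r) := by
    refine ContinuousOn.union_of_isClosed ?_ ?_ hKcl isClosed_sphere
    · exact ((hLG.mono hKW₁).add continuousOn_const).congr hLK
    · exact hLS.congr hLsph
  refine not_exists_log_frontier (isBounded_ball.subset (hUsub.trans inter_subset_right)) hpU hqcl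
    (hLc.mono hfr) fun z hz => ?_
  rcases hfr z hz with hz | hz
  · rw [hLK z hz, Complex.exp_add, hk1, mul_one, hLGe z (hKW₁ hz)]
  · rw [hLsph z hz, hLSe z hz]

/-- `A` is an arc from `a` to `b`. -/
def IsArc {X : Type*} [TopologicalSpace X] (a b : X) (A : Set X) : Prop :=
  ∃ (φ : ℝ → X) (u v : ℝ), u < v ∧ ContinuousOn φ (Icc u v) ∧ InjOn φ (Icc u v) ∧
    φ u = a ∧ φ v = b ∧ φ '' Icc u v = A

namespace IsArc

variable {X : Type*} [TopologicalSpace X] {a b c : X} {A D : Set X}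

lemma left_mem (h : IsArc a b A) : a ∈ A := by
  obtain ⟨φ, u, v, huv, -, -, rfl, -, rfl⟩ := h
  exact mem_image_of_mem _ (left_mem_Icc.2 huv.le)

lemma isCompact (h : IsArc a b A) : IsCompact A := by
  obtain ⟨φ, u, v, -, hc, -, -, -, rfl⟩ := h
  exact isCompact_Icc.image_of_continuousOn hc

lemma symm (h : IsArc a b A) : IsArc b a A := by
  obtain ⟨φ, u, v, huv, hc, hi, ha, hb, rfl⟩ := h
  have hmaps : MapsTo (fun t : ℝ => -t) (Icc (-v) (-u)) (Icc u v) := fun t ht =>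
    ⟨by linarith [ht.2], by linarith [ht.1]⟩
  refine ⟨fun t => φ (-t), -v, -u, neg_lt_neg huv, hc.comp continuousOn_neg hmaps,
    hi.comp neg_injective.injOn hmaps, by simpa using hb, by simpa using ha, ?_⟩
  rw [← Set.image_image φ (fun t => -t), Set.image_neg_eq_neg, Set.neg_Icc, neg_neg, neg_neg]

lemma right_mem (h : IsArc a b A) : b ∈ A := h.symm.left_mem

/-- Two arcs that meet only at a common endpoint form an arc. -/
lemma union (h : IsArc a b A) (h' : IsArc b c D) (hd : A ∩ D ⊆ {b}) : IsArc a c (A ∪ D) := by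
  obtain ⟨φ, u, v, huv, hc, hi, ha, hb, rfl⟩ := h
  obtain ⟨ψ, u', v', huv', hc', hi', ha', hb', rfl⟩ := h'
  set χ : ℝ → X := fun t => if t ≤ v then φ t else ψ (t + (u' - v)) with hχ
  have hχ1 : ∀ t ≤ v, χ t = φ t := fun t ht => if_pos ht
  have hχ2 : ∀ t, v ≤ t → χ t = ψ (t + (u' - v)) := by
    intro t ht
    rcases ht.eq_or_lt with rfl | ht
    · rw [hχ1 v le_rfl, hb, add_sub_cancel, ha']
    · exact if_neg (not_le.2 ht)
  have hmaps : MapsTo (fun t : ℝ => t + (u' - v)) (Icc v (v + (v' - u'))) (Icc u' v') :=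
    fun t ht => ⟨by linarith [ht.1], by linarith [ht.2]⟩
  have hI : Icc u (v + (v' - u')) = Icc u v ∪ Icc v (v + (v' - u')) :=
    (Icc_union_Icc_eq_Icc huv.le (by linarith)).symm
  have him : (fun t : ℝ => t + (u' - v)) '' Icc v (v + (v' - u')) = Icc u' v' := by
    rw [Set.image_add_const_Icc]
    congr 1 <;> ring
  have hcross : ∀ s ∈ Icc u v, ∀ t ∈ Icc v (v + (v' - u')), χ s = χ t → s = t := by
    intro s hs t ht hst
    rw [hχ1 s hs.2, hχ2 t ht.1] at hst
    have h1 : φ s = b :=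
      hd ⟨mem_image_of_mem _ hs, hst ▸ mem_image_of_mem _ (hmaps ht)⟩
    have h2 : s = v := hi hs (right_mem_Icc.2 huv.le) (h1.trans hb.symm)
    have h3 := hi' (hmaps ht) (left_mem_Icc.2 huv'.le) (hst.symm.trans (h1.trans ha'.symm))
    have h4 : t + (u' - v) = u' := h3
    linarith
  refine ⟨χ, u, v + (v' - u'), by linarith, ?_, ?_, (hχ1 u huv.le).trans ha, ?_, ?_⟩
  · rw [hI]
    refine ContinuousOn.union_of_isClosed (hc.congr fun t ht => hχ1 t ht.2) ?_ isClosed_Icc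
      isClosed_Icc
    exact (hc'.comp (continuous_add_const _).continuousOn hmaps).congr fun t ht => hχ2 t ht.1
  · rw [hI]
    rintro s (hs | hs) t (ht | ht) hst
    · exact hi hs ht (by rwa [hχ1 s hs.2, hχ1 t ht.2] at hst)
    · exact hcross s hs t ht hst
    · exact (hcross t ht s hs hst.symm).symm
    · rw [hχ2 s hs.1, hχ2 t ht.1] at hst
      exact add_right_cancel (hi' (hmaps hs) (hmaps ht) hst)
  · rw [hχ2 _ (by linarith), ← hb']
    congr 1
    ring
  · rw [hI, Set.image_union, Set.image_congr fun t (ht : t ∈ Icc u v) => hχ1 t ht.2,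
      Set.image_congr fun t (ht : t ∈ Icc v (v + (v' - u'))) => hχ2 t ht.1,
      ← Set.image_image ψ (fun t => t + (u' - v)), him]

/-- An arc can be cut at any point other than its initial point. -/
lemma exists_initial [T2Space X] (h : IsArc a b A) (hc : c ∈ A) (hca : c ≠ a) :
    ∃ A' R, IsArc a c A' ∧ IsClosed R ∧ a ∉ R ∧ A' ⊆ A ∧ A ⊆ A' ∪ R := by
  obtain ⟨φ, u, v, huv, hcont, hi, rfl, hb, rfl⟩ := h
  obtain ⟨w, hw, rfl⟩ := hc
  have huw : u < w := hw.1.lt_of_ne fun e => hca (e ▸ rfl)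
  refine ⟨φ '' Icc u w, φ '' Icc w v, ⟨φ, u, w, huw, hcont.mono (Icc_subset_Icc_right hw.2),
    hi.mono (Icc_subset_Icc_right hw.2), rfl, rfl, rfl⟩,
    (isCompact_Icc.image_of_continuousOn (hcont.mono (Icc_subset_Icc_left hw.1))).isClosed,
    ?_, image_mono (Icc_subset_Icc_right hw.2), ?_⟩
  · rintro ⟨t, ht, hte⟩
    have := hi ⟨hw.1.trans ht.1, ht.2⟩ (left_mem_Icc.2 huv.le) hte
    linarith [ht.1]
  · rw [← Set.image_union, Icc_union_Icc_eq_Icc hw.1 hw.2]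

/-- An arc meeting a closed set `D` outside its initial point has an initial subarc that meets `D`
exactly at its other endpoint. -/
lemma exists_first_hit [T2Space X] (h : IsArc a b A) (hD : IsClosed D) (ha : a ∉ D)
    (hAD : (A ∩ D).Nonempty) :
    ∃ d ∈ D, ∃ A' R, IsArc a d A' ∧ IsClosed R ∧ a ∉ R ∧ A' ⊆ A ∧ A ⊆ A' ∪ R ∧ A' ∩ D ⊆ {d} := by
  obtain ⟨φ, u, v, huv, hcont, hi, rfl, hb, rfl⟩ := h
  have hcl : IsCompact (Icc u v ∩ φ ⁻¹' D) :=
    isCompact_Icc.of_isClosed_subset (hcont.preimage_isClosed_of_isClosed isClosed_Icc hD)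
      inter_subset_left
  have hne : (Icc u v ∩ φ ⁻¹' D).Nonempty := by
    obtain ⟨_, ⟨t, ht, rfl⟩, htD⟩ := hAD
    exact ⟨t, ht, htD⟩
  obtain ⟨w, ⟨hw, hwD⟩, hmin⟩ := hcl.exists_isLeast hne
  have huw : u < w := hw.1.lt_of_ne fun e => ha (e ▸ hwD)
  refine ⟨φ w, hwD, φ '' Icc u w, φ '' Icc w v, ⟨φ, u, w, huw,
    hcont.mono (Icc_subset_Icc_right hw.2), hi.mono (Icc_subset_Icc_right hw.2), rfl, rfl, rfl⟩,
    (isCompact_Icc.image_of_continuousOn (hcont.mono (Icc_subset_Icc_left hw.1))).isClosed,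
    ?_, image_mono (Icc_subset_Icc_right hw.2), ?_, ?_⟩
  · rintro ⟨t, ht, hte⟩
    have := hi ⟨hw.1.trans ht.1, ht.2⟩ (left_mem_Icc.2 huv.le) hte
    linarith [ht.1]
  · rw [← Set.image_union, Icc_union_Icc_eq_Icc hw.1 hw.2]
  · rintro _ ⟨⟨t, ht, rfl⟩, htD⟩
    have : t = w := le_antisymm ht.2 (hmin ⟨⟨ht.1, ht.2.trans hw.2⟩, htD⟩)
    rw [this]
    rfl

/-- The union of two arcs with a common endpoint contains an arc joining the other two endpoints;
if each of these lies on one arc only, then the new arc contains neighbourhoods of them in the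
given arcs. -/
lemma exists_subset_union [T2Space X] (h : IsArc a b A) (h' : IsArc b c D) (hc : c ∉ A)
    (ha : a ∉ D) : ∃ E R R', IsArc a c E ∧ E ⊆ A ∪ D ∧ IsClosed R ∧ a ∉ R ∧ A ⊆ E ∪ R ∧
      IsClosed R' ∧ c ∉ R' ∧ D ⊆ E ∪ R' := by
  obtain ⟨d, hd, D', R', hD', hR', hcR', hsub', hcov', hint⟩ :=
    h'.symm.exists_first_hit h.isCompact.isClosed hc ⟨b, h'.left_mem, h.right_mem⟩
  obtain ⟨A', R, hA', hR, haR, hsub, hcov⟩ := h.exists_initial hd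
    fun e => ha (e ▸ hsub' hD'.right_mem)
  refine ⟨A' ∪ D', R, R', hA'.union hD'.symm
    (fun _ hz => hint ⟨hz.2, hsub hz.1⟩), union_subset_union hsub hsub', hR, haR,
    hcov.trans (union_subset_union_left _ subset_union_left), hR', hcR',
    hcov'.trans (union_subset_union_left _ subset_union_right)⟩

/-- Arcs can be composed inside their union. -/
lemma exists_trans [T2Space X] (h : IsArc a b A) (h' : IsArc b c D) (hac : a ≠ c) :
    ∃ E ⊆ A ∪ D, IsArc a c E := by
  by_cases hc : c ∈ A
  · obtain ⟨E, -, hE, -, -, hsub, -⟩ := h.exists_initial hc hac.symm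
    exact ⟨E, hsub.trans subset_union_left, hE⟩
  by_cases ha : a ∈ D
  · obtain ⟨E, -, hE, -, -, hsub, -⟩ := h'.symm.exists_initial ha hac
    exact ⟨E, hsub.trans subset_union_right, hE.symm⟩
  obtain ⟨E, -, -, hE, hsub, -⟩ := h.exists_subset_union h' hc ha
  exact ⟨E, hsub, hE⟩

/-- An arc is the range of an injective path. -/
lemma exists_unitInterval (h : IsArc a b A) : ∃ ψ : unitInterval → X,
    Continuous ψ ∧ Function.Injective ψ ∧ ψ 0 = a ∧ ψ 1 = b ∧ Set.range ψ = A := by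
  obtain ⟨φ, u, v, huv, hc, hi, ha, hb, rfl⟩ := h
  set e := (iccHomeoI u v huv).symm with he
  refine ⟨fun t => φ (e t), ?_, ?_, ?_, ?_, ?_⟩
  · exact hc.domRestrict.comp e.continuous
  · exact fun s t hst => e.injective (Subtype.ext (hi (e s).2 (e t).2 hst))
  · simp [he, iccHomeoI_symm_apply_coe, ha]
  · simp [he, iccHomeoI_symm_apply_coe, hb]
  · ext z
    constructor
    · rintro ⟨t, rfl⟩
      exact mem_image_of_mem _ (e t).2
    · rintro ⟨t, ht, rfl⟩
      exact ⟨e.symm ⟨t, ht⟩, by simp⟩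

/-- The image of an initial interval under an injective path is an arc. -/
lemma of_unitInterval {α : unitInterval → X} (hα : Continuous α) (hi : Function.Injective α)
    {s : unitInterval} (hs : 0 < s) : IsArc (α 0) (α s) (α '' Icc 0 s) := by
  have hp : ∀ t : ℝ, ∀ ht : t ∈ Icc (0 : ℝ) 1, Set.projIcc (0 : ℝ) 1 zero_le_one t = ⟨t, ht⟩ :=
    fun t ht => Set.projIcc_of_mem _ ht
  refine ⟨fun t => α (Set.projIcc (0 : ℝ) 1 zero_le_one t), 0, s, hs,
    (hα.comp continuous_projIcc).continuousOn, fun t ht t' ht' htt => ?_, ?_, ?_, ?_⟩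
  · have := hi htt
    rw [hp t ⟨ht.1, ht.2.trans s.2.2⟩, hp t' ⟨ht'.1, ht'.2.trans s.2.2⟩] at this
    exact congrArg Subtype.val this
  · simp only [Set.projIcc_left]
    rfl
  · simp only [Set.projIcc_val]
  · ext z
    constructor
    · rintro ⟨t, ht, rfl⟩
      refine mem_image_of_mem _ ?_
      rw [hp t ⟨ht.1, ht.2.trans s.2.2⟩]
      exact ⟨ht.1, ht.2⟩
    · rintro ⟨t, ht, rfl⟩
      have ht' : (t : ℝ) ∈ Icc (0 : ℝ) s := ⟨ht.1, ht.2⟩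
      exact ⟨t, ht', by simp only [Set.projIcc_val]⟩

lemma segment {E : Type*} [AddCommGroup E] [Module ℝ E] [TopologicalSpace E]
    [IsTopologicalAddGroup E] [ContinuousSMul ℝ E] {a b : E} (hab : a ≠ b) :
    IsArc a b (segment ℝ a b) :=
  ⟨AffineMap.lineMap a b, 0, 1, zero_lt_one, AffineMap.lineMap_continuous.continuousOn,
    (AffineMap.lineMap_injective ℝ hab).injOn, AffineMap.lineMap_apply_zero _ _,
    AffineMap.lineMap_apply_one _ _, (segment_eq_image_lineMap ℝ a b).symm⟩

/-- Two distinct points of a connected open subset of a normed space are joined by an arc. -/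
lemma exists_of_isOpen_of_isPreconnected {E : Type*} [NormedAddCommGroup E] [NormedSpace ℝ E]
    {W : Set E} (hW : IsOpen W) (hWc : IsPreconnected W) {a b : E} (ha : a ∈ W) (hb : b ∈ W)
    (hab : a ≠ b) : ∃ A ⊆ W, IsArc a b A := by
  refine (hWc.induction₂' (fun x y => x = y ∨ ∃ A ⊆ W, IsArc x y A) (fun x hx => ?_) ?_
    ha hb).resolve_left hab
  · obtain ⟨ε, hε, hsub⟩ := Metric.isOpen_iff.1 hW x hx
    filter_upwards [nhdsWithin_le_nhds (ball_mem_nhds x hε)] with y hy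
    by_cases hxy : x = y
    · exact ⟨Or.inl hxy, Or.inl hxy.symm⟩
    · have hseg := ((convex_ball x ε).segment_subset (mem_ball_self hε) hy).trans hsub
      exact ⟨Or.inr ⟨_, hseg, .segment hxy⟩, Or.inr ⟨_, hseg, (IsArc.segment hxy).symm⟩⟩
  · rintro x y z - - - (rfl | ⟨A, hAW, hA⟩) (rfl | ⟨D, hDW, hD⟩)
    · exact Or.inl rfl
    · exact Or.inr ⟨D, hDW, hD⟩
    · exact Or.inr ⟨A, hAW, hA⟩
    · by_cases hxz : x = z
      · exact Or.inl hxz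
      · obtain ⟨F, hF, hFa⟩ := hA.exists_trans hD hxz
        exact Or.inr ⟨F, hF.trans (union_subset hAW hDW), hFa⟩

end IsArc

/-- An initial piece of a path lies in a prescribed neighbourhood of its starting point. -/
lemma exists_image_Icc_subset {X : Type*} [TopologicalSpace X] {α : unitInterval → X}
    (hα : Continuous α) {N : Set X} (hN : N ∈ 𝓝 (α 0)) :
    ∃ s : unitInterval, 0 < s ∧ α '' Icc 0 s ⊆ N := by
  obtain ⟨ε, hε, hsub⟩ := Metric.mem_nhds_iff.1 (hα.continuousAt.preimage_mem_nhds hN)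
  have hpos : 0 < min (ε / 2) 1 := by positivity
  refine ⟨⟨min (ε / 2) 1, hpos.le, min_le_right _ _⟩, hpos, ?_⟩
  rintro _ ⟨t, ht, rfl⟩
  refine hsub ?_
  have h1 : (t : ℝ) ≤ min (ε / 2) 1 := ht.2
  rw [mem_ball, Subtype.dist_eq, Real.dist_eq, Set.Icc.coe_zero, sub_zero, abs_of_nonneg t.2.1]
  linarith [min_le_left (ε / 2) 1]

/-- If an initial piece of a path is covered by `E` and a closed set that does not contain the
starting point, then a smaller initial piece is covered by `E`. -/
lemma exists_image_Icc_subset_of_subset_union {X : Type*} [TopologicalSpace X]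
    {α : unitInterval → X} (hα : Continuous α) {s : unitInterval} (hs : 0 < s) {E R : Set X}
    (hR : IsClosed R) (h0 : α 0 ∉ R) (hsub : α '' Icc 0 s ⊆ E ∪ R) :
    ∃ t : unitInterval, 0 < t ∧ α '' Icc 0 t ⊆ E := by
  obtain ⟨t, ht, htR⟩ := exists_image_Icc_subset hα (hR.isOpen_compl.mem_nhds h0)
  refine ⟨min s t, lt_min hs ht, ?_⟩
  rintro _ ⟨r, hr, rfl⟩
  exact (hsub ⟨r, ⟨hr.1, hr.2.trans (min_le_left _ _)⟩, rfl⟩).resolve_right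
    (htR ⟨r, ⟨hr.1, hr.2.trans (min_le_right _ _)⟩, rfl⟩)

namespace TwoSided

variable {K W₁ W₂ : Set Plane}

lemma isOpen_left (h : TwoSided K W₁ W₂) : IsOpen W₁ := by
  obtain ⟨hK, -, ⟨a, -, rfl⟩, -⟩ := h
  exact hK.isClosed.isOpen_compl.connectedComponentIn

lemma isPreconnected_left (h : TwoSided K W₁ W₂) : IsPreconnected W₁ := by
  obtain ⟨-, -, ⟨a, -, rfl⟩, -⟩ := h
  exact isPreconnected_connectedComponentIn

lemma symm (h : TwoSided K W₁ W₂) : TwoSided K W₂ W₁ :=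
  ⟨h.1, h.2.1.symm, h.2.2.2.1, h.2.2.1, fun x hx => (h.2.2.2.2 x hx).symm⟩

lemma disjoint (h : TwoSided K W₁ W₂) : Disjoint W₁ W₂ := by
  obtain ⟨-, hne, ⟨a, -, rfl⟩, ⟨b, -, rfl⟩, -⟩ := h
  exact disjoint_left.2 fun z hz hz' =>
    hne ((connectedComponentIn_eq hz).trans (connectedComponentIn_eq hz').symm)

lemma union_eq_compl (h : TwoSided K W₁ W₂) : W₁ ∪ W₂ = Kᶜ := by
  obtain ⟨-, -, ⟨a, -, rfl⟩, ⟨b, -, rfl⟩, hall⟩ := h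
  refine (union_subset (connectedComponentIn_subset _ _)
    (connectedComponentIn_subset _ _)).antisymm fun z hz => ?_
  exact (hall z hz).imp (fun e => e.subset (mem_connectedComponentIn hz))
    fun e => e.subset (mem_connectedComponentIn hz)

end TwoSided

lemma IsSimpleSet.subset_closure_right {K W₁ W₂ : Set Plane} (h : IsSimpleSet K W₁ W₂) :
    K ⊆ closure W₂ :=
  h.2.2.trans (closure_minimal (fun _ hz => frontier_subset_closure hz.2.1) isClosed_closure)

/-- Two accessible points that lie in a common continuum in `K` and in a disc are joined by a
cross-cut in that disc, which may be chosen to start and end along prescribed end-cuts. -/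
lemma IsSimpleSet.exists_crossCut {K W₁ W₂ C : Set Plane} (h : IsSimpleSet K W₁ W₂)
    {x y z : Plane} {r : ℝ} (hC : IsPreconnected C) (hCc : IsCompact C) (hCK : C ⊆ K)
    (hCB : C ⊆ ball x r) (hy : y ∈ C) (hz : z ∈ C) (hyz : y ≠ z) (hyf : y ∈ frontier W₁)
    (hzf : z ∈ frontier W₁) {α α' : unitInterval → Plane} (hα : IsEndCut W₁ y α)
    (hα' : IsEndCut W₁ z α') :
    ∃ (β : unitInterval → Plane) (s t : unitInterval),
      IsCrossCut W₁ β ∧ β 0 = y ∧ β 1 = z ∧ Set.range β ⊆ ball x r ∧ 0 < s ∧ 0 < t ∧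
      α '' Set.Icc 0 s ⊆ Set.range β ∧ α' '' Set.Icc 0 t ⊆ Set.range β := by
  obtain ⟨hαc, hαi, hα0, hαW⟩ := hα
  obtain ⟨hαc', hαi', hα0', hαW'⟩ := hα'
  obtain ⟨N, N', hN, hN', hyN, hzN', hNN'⟩ := t2_separation hyz
  obtain ⟨s, hs, hsN⟩ := exists_image_Icc_subset hαc
    (N := N ∩ ball x r) ((hN.inter isOpen_ball).mem_nhds (hα0.symm ▸ ⟨hyN, hCB hy⟩))
  obtain ⟨t, ht, htN⟩ := exists_image_Icc_subset hαc'
    (N := N' ∩ ball x r) ((hN'.inter isOpen_ball).mem_nhds (hα0'.symm ▸ ⟨hzN', hCB hz⟩))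
  have hD := IsArc.of_unitInterval hαc hαi hs
  have hD' := IsArc.of_unitInterval hαc' hαi' ht
  rw [hα0] at hD
  rw [hα0'] at hD'
  have hDW : ∀ w ∈ α '' Icc 0 s, w = y ∨ w ∈ W₁ := by
    rintro _ ⟨u, -, rfl⟩
    by_cases hu : u = 0
    · exact Or.inl (hu ▸ hα0)
    · exact Or.inr (hαW u hu)
  have hDW' : ∀ w ∈ α' '' Icc 0 t, w = z ∨ w ∈ W₁ := by
    rintro _ ⟨u, -, rfl⟩
    by_cases hu : u = 0
    · exact Or.inl (hu ▸ hα0')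
    · exact Or.inr (hαW' u hu)
  have hdisj : ∀ w ∈ α '' Icc 0 s, w ∉ α' '' Icc 0 t := fun w hw hw' =>
    hNN'.le_bot ⟨(hsN hw).1, (htN hw').1⟩
  have hKW : ∀ w ∈ K, w ∉ W₁ := fun w hw hw' => by
    have : w ∈ Kᶜ := h.1.union_eq_compl ▸ Or.inl hw'
    exact this hw
  have hpW := hαW s hs.ne'
  have hqW := hαW' t ht.ne'
  have hcon : α' t ∈ connectedComponentIn (W₁ ∩ ball x r) (α s) := by
    refine mem_connectedComponentIn_inter_ball (Q := α '' Icc 0 s ∪ C ∪ α' '' Icc 0 t)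
      h.1.isOpen_left h.1.isPreconnected_left h.1.symm.isOpen_left h.1.symm.isPreconnected_left
      h.1.disjoint h.1.union_eq_compl h.subset_closure_right
      ((hD.isCompact.union hCc).union hD'.isCompact) ?_ ?_ ?_ (Or.inl (Or.inl hD.right_mem))
      (Or.inr hD'.right_mem) hpW hqW
    · refine IsPreconnected.union z (Or.inr hz) hD'.left_mem ?_
        (isPreconnected_Icc.image _ hαc'.continuousOn)
      exact IsPreconnected.union y hD.left_mem hy (isPreconnected_Icc.image _ hαc.continuousOn) hC
    · exact union_subset (union_subset (hsN.trans inter_subset_right) hCB)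
        (htN.trans inter_subset_right)
    · refine union_subset (union_subset (fun w hw => ?_) (hCK.trans subset_union_left))
        fun w hw => ?_
      · exact (hDW w hw).imp_left fun e => mem_of_eq_of_mem e (hCK hy)
      · exact (hDW' w hw).imp_left fun e => mem_of_eq_of_mem e (hCK hz)
  have hpB : α s ∈ W₁ ∩ ball x r := ⟨hpW, (hsN hD.right_mem).2⟩
  obtain ⟨A, hAsub, hA⟩ := IsArc.exists_of_isOpen_of_isPreconnected
    (h.1.isOpen_left.inter isOpen_ball).connectedComponentIn isPreconnected_connectedComponentIn
    (mem_connectedComponentIn hpB) hcon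
    fun e => hdisj _ hD.right_mem (e ▸ hD'.right_mem)
  have hAW : A ⊆ W₁ ∩ ball x r := hAsub.trans (connectedComponentIn_subset _ _)
  obtain ⟨E, R, -, hE, hEsub, hR, hyR, hDE, -⟩ := hD.exists_subset_union hA
    (fun hq => hdisj _ hq hD'.right_mem) fun hyA => hKW y (hCK hy) (hAW hyA).1
  obtain ⟨F, S, S', hF, hFsub, hS, hyS, hES, hS', hzS', hDS'⟩ := hE.exists_subset_union hD'.symm
    (fun hzE => (hEsub hzE).elim (fun hzD => hdisj z hzD hD'.left_mem)
      fun hzA => hKW z (hCK hz) (hAW hzA).1) (hdisj y hD.left_mem)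
  have hFB : F ⊆ ball x r := hFsub.trans (union_subset (hEsub.trans
    (union_subset (hsN.trans inter_subset_right) (hAW.trans inter_subset_right)))
    (htN.trans inter_subset_right))
  have hFW : ∀ w ∈ F, w = y ∨ w = z ∨ w ∈ W₁ := by
    intro w hw
    rcases hFsub hw with hw | hw
    · rcases hEsub hw with hw | hw
      · exact (hDW w hw).imp id Or.inr
      · exact Or.inr (Or.inr (hAW hw).1)
    · exact Or.inr (hDW' w hw)
  obtain ⟨β, hβc, hβi, hβ0, hβ1, hβF⟩ := hF.exists_unitInterval
  obtain ⟨s', hs', hs'F⟩ := exists_image_Icc_subset_of_subset_union hαc hs (hS.union hR)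
    (by rw [hα0]; exact fun hmem => hmem.elim hyS hyR)
    (hDE.trans ((union_subset_union_left R hES).trans (union_assoc F S R).subset))
  obtain ⟨t', ht', ht'F⟩ := exists_image_Icc_subset_of_subset_union hαc' ht hS'
    (by rwa [hα0']) hDS'
  refine ⟨β, s', t', ⟨hβc, hβi, hβ0 ▸ hyf, hβ1 ▸ hzf, fun u hu0 hu1 => ?_⟩, hβ0, hβ1,
    hβF ▸ hFB, hs', ht', hβF ▸ hs'F, hβF ▸ ht'F⟩
  rcases hFW (β u) (hβF ▸ mem_range_self u) with hu | hu | hu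
  · exact absurd (hβi (hu.trans hβ0.symm)) hu0
  · exact absurd (hβi (hu.trans hβ1.symm)) hu1
  · exact hu

/-- **Lemma 1.3.** Let `K` be a simple set, `x ∈ K`, and `(xₙ)_{n ≥ 1}` a sequence of
pairwise distinct points, different from `x`, with `xₙ ∈ K(B(x,1/n), x) ∩ A₁`, together
with end-cuts `αₙ` of `W₁` at `xₙ`. Then there is a family of cross-cuts `βₙ` (`n ≥ 2`) of
`W₁` such that `βₙ` joins `xₙ` to `x_{n+1}`, `βₙ(I) ⊆ B(x, 1/(n-1))`, and there are
`τₙ > 0` with `α₂([0,τ₂]) ⊆ β₂(I)` and `αₙ([0,τₙ]) ⊆ β_{n-1}(I) ∩ βₙ(I)` for `n ≥ 3`. -/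
theorem exists_crossCut_family (K W₁ W₂ : Set Plane) (h : IsSimpleSet K W₁ W₂)
    (x : Plane) (hx : x ∈ K) (xs : ℕ → Plane)
    (hdist : ∀ m n : ℕ, 1 ≤ m → 1 ≤ n → m ≠ n → xs m ≠ xs n)
    (hnex : ∀ n : ℕ, 1 ≤ n → xs n ≠ x)
    (hmem : ∀ n : ℕ, 1 ≤ n →
      xs n ∈ connectedComponentIn (K ∩ ball x (1 / (n : ℝ))) x ∩ AccPts K W₁)
    (α : ℕ → unitInterval → Plane)
    (hα : ∀ n : ℕ, 1 ≤ n → IsEndCut W₁ (xs n) (α n)) :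
    ∃ (β : ℕ → unitInterval → Plane) (τ : ℕ → unitInterval),
      ∀ n : ℕ, 2 ≤ n →
        IsCrossCut W₁ (β n) ∧ β n 0 = xs n ∧ β n 1 = xs (n + 1) ∧
        Set.range (β n) ⊆ ball x (1 / ((n : ℝ) - 1)) ∧
        0 < τ n ∧
        α 2 '' Set.Icc 0 (τ 2) ⊆ Set.range (β 2) ∧
        (3 ≤ n → α n '' Set.Icc 0 (τ n) ⊆ Set.range (β (n - 1)) ∩ Set.range (β n)) := by
  have hloc : ∀ n : ℕ, 2 ≤ n → ∃ (β : unitInterval → Plane) (s t : unitInterval),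
      IsCrossCut W₁ β ∧ β 0 = xs n ∧ β 1 = xs (n + 1) ∧
      Set.range β ⊆ ball x (1 / ((n : ℝ) - 1)) ∧ 0 < s ∧ 0 < t ∧
      α n '' Set.Icc 0 s ⊆ Set.range β ∧ α (n + 1) '' Set.Icc 0 t ⊆ Set.range β := by
    intro n hn
    have hn' : (2 : ℝ) ≤ n := by exact_mod_cast hn
    have hsub : closedBall x (1 / (n : ℝ)) ⊆ ball x (1 / ((n : ℝ) - 1)) :=
      closedBall_subset_ball (one_div_lt_one_div_of_lt (by linarith) (by linarith))
    have hmono : connectedComponentIn (K ∩ ball x (1 / ((n + 1 : ℕ) : ℝ))) x ⊆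
        connectedComponentIn (K ∩ ball x (1 / (n : ℝ))) x :=
      connectedComponentIn_mono _ (Set.inter_subset_inter_right _
        (ball_subset_ball (one_div_le_one_div_of_le (by linarith) (by push_cast; linarith))))
    have hcc : connectedComponentIn (K ∩ ball x (1 / (n : ℝ))) x ⊆ K ∩ closedBall x (1 / (n : ℝ)) :=
      (connectedComponentIn_subset _ _).trans
        (Set.inter_subset_inter_right _ ball_subset_closedBall)
    have hKc : closure (connectedComponentIn (K ∩ ball x (1 / (n : ℝ))) x) ⊆
        K ∩ closedBall x (1 / (n : ℝ)) :=
      closure_minimal hcc (h.1.1.isClosed.inter isClosed_closedBall)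
    exact h.exists_crossCut (isPreconnected_connectedComponentIn.closure)
      (h.1.1.of_isClosed_subset isClosed_closure (hKc.trans inter_subset_left))
      (hKc.trans inter_subset_left) (hKc.trans (inter_subset_right.trans hsub))
      (subset_closure (hmem n (by omega)).1)
      (subset_closure (hmono (hmem (n + 1) (by omega)).1))
      (hdist n (n + 1) (by omega) (by omega) (by omega)) (hmem n (by omega)).2.2.1
      (hmem (n + 1) (by omega)).2.2.1 (hα n (by omega)) (hα (n + 1) (by omega))
  choose! β s t hcross h0 h1 hrange hs ht hsα htα using hloc
  refine ⟨β, fun n => if 3 ≤ n then min (s n) (t (n - 1)) else s n, fun n hn =>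
    ⟨hcross n hn, h0 n hn, h1 n hn, hrange n hn, ?_, ?_, fun h3 => ?_⟩⟩
  · dsimp only
    split_ifs with h3
    · exact lt_min (hs n hn) (ht (n - 1) (by omega))
    · exact hs n hn
  · simpa using hsα 2 le_rfl
  · simp only [if_pos h3]
    refine subset_inter ?_ ?_
    · have := htα (n - 1) (by omega)
      rw [Nat.sub_add_cancel (by omega)] at this
      exact (image_mono (Icc_subset_Icc_right (min_le_right _ _))).trans this
    · exact (image_mono (Icc_subset_Icc_right (min_le_left _ _))).trans (hsα n hn)
end
end

section
/- Let K ⊆ ℝ² be a connected compact set whose complement has exactly two connected components W₁ and W₂, and let A₁, A₂ be the sets of points of K accessible from W₁ and W₂ respectively. If the subspaces K \ A₁ and K \ A₂ are zero-dimensional (each has a basis of sets that are clopen in its subspace topology), then K is a d-set: both A₁ and A₂ are sufficiently dense in K. -/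
open Set Metric Topology

noncomputable section

/-- A preconnected subset of a zero-dimensional subspace of a `T1` space has at most one point. -/
theorem ZeroDimensional.subsingleton_of_isPreconnected {X : Type*} [TopologicalSpace X] [T1Space X]
    {S C : Set X} (hS : ZeroDimensional ↥S) (hCS : C ⊆ S) (hC : IsPreconnected C) :
    C.Subsingleton := by
  intro a ha b hb
  by_contra hab
  obtain ⟨V, hV, haV, hVb⟩ := hS ⟨a, hCS ha⟩ {⟨b, hCS hb⟩}ᶜ isOpen_compl_singleton
    (fun h => hab (congrArg Subtype.val h))
  have hpre : IsPreconnected ((↑) ⁻¹' C : Set S) := by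
    rw [← IsInducing.subtypeVal.isPreconnected_image, Subtype.image_preimage_coe,
      inter_eq_right.mpr hCS]
    exact hC
  exact hVb (hpre.subset_isClopen hV ⟨⟨a, hCS ha⟩, ha, haV⟩
    (show (⟨b, hCS hb⟩ : S) ∈ ((↑) ⁻¹' C : Set S) from hb)) rfl

/-- In a compact Hausdorff space, every neighborhood of a point that is its own connected
component contains a clopen neighborhood of that point. -/
theorem exists_isClopen_subset_of_connectedComponent_subset {X : Type*} [TopologicalSpace X]
    [CompactSpace X] [T2Space X] {x : X} {U : Set X} (hU : IsOpen U)
    (hx : connectedComponent x ⊆ U) : ∃ V, IsClopen V ∧ x ∈ V ∧ V ⊆ U := by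
  rw [connectedComponent_eq_iInter_isClopen] at hx
  have : Nonempty { s : Set X // IsClopen s ∧ x ∈ s } := ⟨⟨univ, isClopen_univ, mem_univ x⟩⟩
  obtain ⟨V, hV⟩ := exists_subset_nhds_of_compactSpace
    (V := fun s : { s : Set X // IsClopen s ∧ x ∈ s } => (s : Set X))
    (fun s t => ⟨⟨s ∩ t, s.2.1.inter t.2.1, s.2.2, t.2.2⟩, inter_subset_left, inter_subset_right⟩)
    (fun s => s.2.1.isClosed) (fun y hy => hU.mem_nhds (hx hy))
  exact ⟨V, V.2.1, V.2.2, hV⟩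

/-- Components of relatively open subsets of a nondegenerate continuum are nondegenerate. -/
theorem nontrivial_connectedComponentIn_inter {X : Type*} [MetricSpace X] {K U : Set X} {x : X}
    (hKc : IsCompact K) (hK : IsPreconnected K) (hKn : K.Nontrivial) (hx : x ∈ K)
    (hU : IsOpen U) (hxU : x ∈ U) : (connectedComponentIn (K ∩ U) x).Nontrivial := by
  by_contra hn
  rw [not_nontrivial_iff] at hn
  obtain ⟨y, hy, hyx⟩ := hKn.exists_ne x
  obtain ⟨ε, hε, hεU⟩ := Metric.isOpen_iff.mp hU x hxU
  obtain ⟨r, hr, hrlt⟩ := exists_between (lt_min hε (dist_pos.mpr hyx))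
  have hrU : closedBall x r ⊆ U :=
    (closedBall_subset_ball (hrlt.trans_le (min_le_left _ _))).trans hεU
  have hyr : y ∉ closedBall x r := by
    simpa using hrlt.trans_le (min_le_right _ _)
  set T := K ∩ closedBall x r with hT
  have hTc : IsCompact T := hKc.inter_right isClosed_closedBall
  have : CompactSpace T := isCompact_iff_compactSpace.mp hTc
  have hxT : x ∈ T := ⟨hx, mem_closedBall_self hr.le⟩
  have hxK : x ∈ K ∩ U := ⟨hx, hxU⟩
  have hcomp : connectedComponent (⟨x, hxT⟩ : T) ⊆ (↑) ⁻¹' ball x r := by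
    intro z hz
    have hz' : (z : X) ∈ connectedComponentIn (K ∩ U) x := by
      refine connectedComponentIn_mono x (inter_subset_inter_right K hrU) ?_
      rw [connectedComponentIn_eq_image hxT]
      exact ⟨z, hz, rfl⟩
    have hzx : (z : X) = x := hn hz' (mem_connectedComponentIn hxK)
    simpa [hzx] using hr
  obtain ⟨V, hV, hxV, hVr⟩ := exists_isClopen_subset_of_connectedComponent_subset
    (isOpen_ball.preimage continuous_subtype_val) hcomp
  obtain ⟨O, hO, rfl⟩ := isOpen_induced_iff.mp hV.isOpen
  have hVc : IsClosed ((↑) '' ((↑) ⁻¹' O : Set T) : Set X) :=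
    (hV.isClosed.isCompact.image continuous_subtype_val).isClosed
  rw [Subtype.image_preimage_coe] at hVc
  have hmem : ∀ z ∈ K, z ∈ O ∩ ball x r ↔ z ∈ T ∩ O := fun z hz =>
    ⟨fun h => ⟨⟨hz, ball_subset_closedBall h.2⟩, h.1⟩,
      fun h => ⟨h.2, hVr (show (⟨z, h.1⟩ : T) ∈ _ from h.2)⟩⟩
  obtain ⟨z, hzK, hz, hz'⟩ := hK (O ∩ ball x r) (T ∩ O)ᶜ (hO.inter isOpen_ball) hVc.isOpen_compl
    (fun z hz => (em (z ∈ T ∩ O)).imp (hmem z hz).mpr id)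
    ⟨x, hx, hxV, mem_ball_self hr⟩ ⟨y, hy, fun h => hyr h.1.2⟩
  exact hz' ((hmem z hzK).mp hz)

/-- A set whose complement in a nondegenerate plane continuum is zero-dimensional is sufficiently
dense in that continuum. -/
theorem suffDense_of_zeroDimensional_diff {K R : Set Plane} (hKc : IsCompact K)
    (hK : IsPreconnected K) (hKn : K.Nontrivial) (hR : ZeroDimensional ↥(K \ R)) :
    SuffDense K R := by
  intro x hx U hU hxU
  by_contra hempty
  refine (nontrivial_connectedComponentIn_inter hKc hK hKn hx hU hxU).not_subsingleton
    (hR.subsingleton_of_isPreconnected (fun z hz => ?_) isPreconnected_connectedComponentIn)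
  exact ⟨(connectedComponentIn_subset _ _ hz).1, fun hzR => hempty ⟨z, hz, hzR⟩⟩

/-- A two-sided set has at least two points. -/
theorem TwoSided.nontrivial {K W₁ W₂ : Set Plane} (h : TwoSided K W₁ W₂) : K.Nontrivial := by
  by_contra hn
  obtain ⟨-, hne, ⟨x, hx, rfl⟩, ⟨y, hy, rfl⟩, -⟩ := h
  have hrank : 1 < Module.rank ℝ Plane := by
    rw [← Module.finrank_eq_rank, finrank_euclideanSpace_fin]
    norm_num
  have hconn : IsPreconnected Kᶜ :=
    ((not_nontrivial_iff.mp hn).countable.isConnected_compl_of_one_lt_rank hrank).isPreconnected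
  exact hne (by rw [hconn.connectedComponentIn hx, hconn.connectedComponentIn hy])

/-- **Lemma 1.2.** Let `K` be a connected two-sided compact set in the plane. If the
subspaces `K \ A₁` and `K \ A₂` are zero-dimensional, then `K` is a d-set. -/
theorem zeroDim_isDSet (K W₁ W₂ : Set Plane) (hK : IsConnected K)
    (hts : TwoSided K W₁ W₂)
    (h1 : ZeroDimensional ↥(K \ AccPts K W₁))
    (h2 : ZeroDimensional ↥(K \ AccPts K W₂)) :
    IsDSet K W₁ W₂ := by
  exact ⟨hts, suffDense_of_zeroDimensional_diff hts.1 hK.isPreconnected hts.nontrivial h1,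
    suffDense_of_zeroDimensional_diff hts.1 hK.isPreconnected hts.nontrivial h2⟩
end
end
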